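/- Let Λ be a nonempty index set and for each λ ∈ Λ let (G_λ, d_λ) be a group equipped with a two-sided invariant metric. Let A be a group together with injective group homomorphisms φ_λ : A → G_λ such that φ_λ(A) is closed in (G_λ, d_λ) for every λ and d_{λ₁}(φ_{λ₁}(a), φ_{λ₁}(a')) = d_{λ₂}(φ_{λ₂}(a), φ_{λ₂}(a')) for all a, a' ∈ A and all λ₁, λ₂ ∈ Λ. Then there exists a two-sided invariant metric d̄ on ∐_A G_λ extending the amalgam metric which is maximal among all such metrics: for every two-sided invariant metric δ on ∐_A G_λ extending the amalgam metric, δ(x, y) ≤ d̄(x, y) for all x, y ∈ ∐_A G_λ. -/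

import Mathlib

/-- A two-sided invariant metric on a group. -/
def IsTSIMetric {G : Type*} [Group G] (d : G → G → ℝ) : Prop :=
  (∀ x y : G, d x y = 0 ↔ x = y) ∧
  (∀ x y : G, d x y = d y x) ∧
  (∀ x y z : G, d x z ≤ d x y + d y z) ∧
  (∀ g x y : G, d (g * x) (g * y) = d x y) ∧
  (∀ g x y : G, d (x * g) (y * g) = d x y)

/-- A set is closed with respect to the metric `d`. -/
def IsDClosed {G : Type*} (d : G → G → ℝ) (S : Set G) : Prop :=
  ∀ x : G, (∀ ε : ℝ, 0 < ε → ∃ s ∈ S, d x s < ε) → x ∈ S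

/-- A metric on the amalgamated free product extends the amalgam metric: it restricts to `d λ`
on each factor and realizes the amalgam distance between elements of distinct factors. -/
def ExtendsAmalgamMetric {Λ : Type*} {G : Λ → Type*} [∀ l, Group (G l)]
    {A : Type*} [Group A] (φ : ∀ l, A →* G l) (d : ∀ l, G l → G l → ℝ)
    (dbar : Monoid.PushoutI φ → Monoid.PushoutI φ → ℝ) : Prop :=
  (∀ (l : Λ) (g h : G l),
    dbar (Monoid.PushoutI.of (φ := φ) l g) (Monoid.PushoutI.of (φ := φ) l h) = d l g h) ∧
  (∀ (l₁ l₂ : Λ), l₁ ≠ l₂ → ∀ (g₁ : G l₁) (g₂ : G l₂),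
    dbar (Monoid.PushoutI.of (φ := φ) l₁ g₁) (Monoid.PushoutI.of (φ := φ) l₂ g₂)
      = ⨅ a : A, (d l₁ g₁ (φ l₁ a) + d l₂ (φ l₂ a) g₂))

open Monoid

namespace IsTSIMetric

variable {G : Type*} [Group G] {d : G → G → ℝ}

theorem self (h : IsTSIMetric d) (x : G) : d x x = 0 := (h.1 x x).2 rfl

theorem symm (h : IsTSIMetric d) (x y : G) : d x y = d y x := h.2.1 x y

theorem triangle (h : IsTSIMetric d) (x y z : G) : d x z ≤ d x y + d y z := h.2.2.1 x y z

theorem mul_left (h : IsTSIMetric d) (g x y : G) : d (g * x) (g * y) = d x y := h.2.2.2.1 g x y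

theorem mul_right (h : IsTSIMetric d) (g x y : G) : d (x * g) (y * g) = d x y := h.2.2.2.2 g x y

theorem nonneg (h : IsTSIMetric d) (x y : G) : 0 ≤ d x y := by
  have := h.triangle x y x
  rw [h.self, h.symm y x] at this
  linarith

theorem inv_inv (h : IsTSIMetric d) (x y : G) : d x⁻¹ y⁻¹ = d x y := by
  rw [← h.mul_left x, ← h.mul_right y]
  simp [h.symm]

end IsTSIMetric

namespace GraevMetric

variable {Λ : Type*} {G : Λ → Type*}

/-- The words `w` and `z` have letters in the same factors, and the sum of the distances of
corresponding letters is at most `c`. -/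
inductive Close (d : ∀ l, G l → G l → ℝ) : List (Σ l, G l) → List (Σ l, G l) → ℝ → Prop
  | nil {c : ℝ} : 0 ≤ c → Close d [] [] c
  | cons (l : Λ) (g k : G l) {w z : List (Σ l, G l)} {c c' : ℝ} :
      Close d w z c → d l g k + c ≤ c' → Close d (⟨l, g⟩ :: w) (⟨l, k⟩ :: z) c'

section

variable {d : ∀ l, G l → G l → ℝ}

theorem Close.mono {w z : List (Σ l, G l)} {c c' : ℝ} (h : Close d w z c) (hc : c ≤ c') :
    Close d w z c' := by
  cases h with
  | nil h => exact .nil (h.trans hc)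
  | cons l g k h h' => exact .cons l g k h (h'.trans hc)

theorem Close.of_cons {l : Λ} {g : G l} {w z : List (Σ l, G l)} {c : ℝ}
    (h : Close d (⟨l, g⟩ :: w) z c) :
    ∃ (k : G l) (z' : List (Σ l, G l)) (c' : ℝ),
      z = ⟨l, k⟩ :: z' ∧ Close d w z' c' ∧ d l g k + c' ≤ c := by
  cases h with
  | cons l g k h h' => exact ⟨k, _, _, rfl, h, h'⟩

theorem Close.append {v v' w w' : List (Σ l, G l)} {b c : ℝ} (h : Close d v v' b)
    (h' : Close d w w' c) : Close d (v ++ w) (v' ++ w') (b + c) := by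
  induction h with
  | nil hb => exact h'.mono (by linarith)
  | cons l g k _ hb ih => exact .cons l g k ih (by linarith)

theorem Close.of_append {v w z : List (Σ l, G l)} {c : ℝ} (h : Close d (v ++ w) z c) :
    ∃ v' w' b b', z = v' ++ w' ∧ Close d v v' b ∧ Close d w w' b' ∧ b + b' ≤ c := by
  induction v generalizing z c with
  | nil => exact ⟨[], z, 0, c, rfl, .nil le_rfl, h, by simp⟩
  | cons p v ih =>
    obtain ⟨l, g⟩ := p
    obtain ⟨k, z', c', rfl, h1, h2⟩ := h.of_cons
    obtain ⟨v', w', b, b', rfl, h3, h4, h5⟩ := ih h1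
    exact ⟨⟨l, k⟩ :: v', w', d l g k + b, b', rfl, .cons l g k h3 le_rfl, h4, by linarith⟩

theorem Close.isChain_iff {w z : List (Σ l, G l)} {c : ℝ} (h : Close d w z c) :
    w.IsChain (fun p q => p.1 ≠ q.1) ↔ z.IsChain (fun p q => p.1 ≠ q.1) := by
  induction h with
  | nil => rfl
  | cons l g k h _ ih => cases h <;> simp_all

end

variable [∀ l, Group (G l)] {A : Type*} [Group A]

/-- The element of the amalgamated product spelled by a word. -/
def wordProd (φ : ∀ l, A →* G l) (w : List (Σ l, G l)) : PushoutI φ :=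
  (w.map fun p => PushoutI.of (φ := φ) p.1 p.2).prod

/-- The word spelling the inverse. -/
def wordInv (w : List (Σ l, G l)) : List (Σ l, G l) :=
  (w.map fun p => ⟨p.1, p.2⁻¹⟩).reverse

/-- A word without two adjacent letters in the same factor and without letters in the
amalgamated subgroup. -/
def IsReducedWord (φ : ∀ l, A →* G l) (w : List (Σ l, G l)) : Prop :=
  w.IsChain (fun p q => p.1 ≠ q.1) ∧ ∀ p ∈ w, p.2 ∉ (φ p.1).range

/-- One step of rewriting a word to a shorter one: multiply two adjacent letters of the same
factor, or absorb a letter of the amalgamated subgroup into a neighbour. -/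
inductive Step (φ : ∀ l, A →* G l) : List (Σ l, G l) → List (Σ l, G l) → Prop
  | merge (l : Λ) (g h : G l) (y : List (Σ l, G l)) :
      Step φ (⟨l, g⟩ :: ⟨l, h⟩ :: y) (⟨l, g * h⟩ :: y)
  | absorbRight (m : Λ) (a : A) (l : Λ) (k : G l) (y : List (Σ l, G l)) :
      Step φ (⟨m, φ m a⟩ :: ⟨l, k⟩ :: y) (⟨l, φ l a * k⟩ :: y)
  | absorbLeft (l : Λ) (k : G l) (m : Λ) (a : A) (y : List (Σ l, G l)) :
      Step φ (⟨l, k⟩ :: ⟨m, φ m a⟩ :: y) (⟨l, k * φ l a⟩ :: y)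
  | cons (p : Σ l, G l) {v w : List (Σ l, G l)} : Step φ v w → Step φ (p :: v) (p :: w)

/-- The word `w` is within `c` of a word spelling the identity. -/
def NearTrivial (φ : ∀ l, A →* G l) (d : ∀ l, G l → G l → ℝ) (w : List (Σ l, G l))
    (c : ℝ) : Prop :=
  ∃ z, Close d w z c ∧ wordProd φ z = 1

section Words

variable (φ : ∀ l, A →* G l)

@[simp]
theorem wordProd_nil : wordProd φ [] = 1 := rfl

@[simp]
theorem wordProd_cons (p : Σ l, G l) (w : List (Σ l, G l)) :
    wordProd φ (p :: w) = PushoutI.of (φ := φ) p.1 p.2 * wordProd φ w := by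
  simp [wordProd]

@[simp]
theorem wordProd_append (v w : List (Σ l, G l)) :
    wordProd φ (v ++ w) = wordProd φ v * wordProd φ w := by
  simp [wordProd]

@[simp]
theorem wordProd_wordInv (w : List (Σ l, G l)) : wordProd φ (wordInv w) = (wordProd φ w)⁻¹ := by
  induction w with
  | nil => simp [wordInv]
  | cons p w ih =>
    have : wordInv (p :: w) = wordInv w ++ [⟨p.1, p.2⁻¹⟩] := by simp [wordInv]
    simp [this, ih]

theorem exists_wordProd_eq [Nonempty Λ] (x : PushoutI φ) : ∃ w, wordProd φ w = x := by
  induction x using PushoutI.induction_on with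
  | of i g => exact ⟨[⟨i, g⟩], by simp⟩
  | base h =>
    obtain ⟨l⟩ := ‹Nonempty Λ›
    exact ⟨[⟨l, φ l h⟩], by simp [PushoutI.of_apply_eq_base]⟩
  | mul x y hx hy =>
    obtain ⟨v, rfl⟩ := hx
    obtain ⟨w, rfl⟩ := hy
    exact ⟨v ++ w, by simp⟩

variable {φ}

theorem IsReducedWord.eq_nil (hinj : ∀ l, Function.Injective (φ l)) {w : List (Σ l, G l)}
    (hw : IsReducedWord φ w) (h : wordProd φ w = 1) : w = [] := by
  let W : CoprodI.Word G := ⟨w, fun p hp h1 => hw.2 p hp (h1 ▸ one_mem _), hw.1⟩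
  have hW : PushoutI.ofCoprodI (φ := φ) W.prod = 1 := by
    rw [← h]
    simp [W, CoprodI.Word.prod, wordProd, map_list_prod, Function.comp_def]
  have hred : PushoutI.Reduced φ W := hw.2
  have := hred.eq_empty_of_mem_range hinj (hW ▸ one_mem _)
  exact congrArg CoprodI.Word.toList this

theorem Step.length_eq {w w' : List (Σ l, G l)} (h : Step φ w w') :
    w.length = w'.length + 1 := by
  induction h <;> simp_all

theorem Step.wordProd_eq {w w' : List (Σ l, G l)} (h : Step φ w w') :
    wordProd φ w = wordProd φ w' := by
  induction h <;> simp_all [PushoutI.of_apply_eq_base, mul_assoc]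

theorem exists_step (φ : ∀ l, A →* G l) (w : List (Σ l, G l)) :
    w = [] ∨ (∃ p, w = [p]) ∨ IsReducedWord φ w ∨ ∃ w', Step φ w w' := by
  induction w with
  | nil => exact Or.inl rfl
  | cons p t ih =>
    obtain _ | ⟨q, t⟩ := t
    · exact Or.inr (Or.inl ⟨p, rfl⟩)
    refine Or.inr (Or.inr ?_)
    obtain ⟨l, g⟩ := p
    obtain ⟨m, h⟩ := q
    by_cases hlm : l = m
    · subst hlm
      exact Or.inr ⟨_, Step.merge ..⟩
    by_cases hg : g ∈ (φ l).range
    · obtain ⟨a, rfl⟩ := hg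
      exact Or.inr ⟨_, Step.absorbRight ..⟩
    by_cases hh : h ∈ (φ m).range
    · obtain ⟨a, rfl⟩ := hh
      exact Or.inr ⟨_, Step.absorbLeft ..⟩
    have key : IsReducedWord φ (⟨m, h⟩ :: t) ∨ ∃ w', Step φ (⟨m, h⟩ :: t) w' := by
      obtain h0 | ⟨p, hp⟩ | h0 := ih
      · cases h0
      · obtain ⟨rfl, rfl⟩ := List.cons.inj hp
        exact Or.inl ⟨by simp, by simpa using hh⟩
      · exact h0
    obtain ⟨h1, h2⟩ | ⟨w', hw'⟩ := key
    · refine Or.inl ⟨List.isChain_cons_cons.2 ⟨hlm, h1⟩, ?_⟩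
      rintro p hp
      obtain rfl | hp := List.mem_cons.1 hp
      · exact hg
      · exact h2 p hp
    · exact Or.inr ⟨_, Step.cons _ hw'⟩

end Words

section Close

variable {d : ∀ l, G l → G l → ℝ} (hd : ∀ l, IsTSIMetric (d l))
include hd

theorem Close.refl (w : List (Σ l, G l)) : Close d w w 0 := by
  induction w with
  | nil => exact .nil le_rfl
  | cons p w ih => exact .cons p.1 p.2 p.2 ih (by simp [(hd _).self])

theorem Close.nonneg {w z : List (Σ l, G l)} {c : ℝ} (h : Close d w z c) : 0 ≤ c := by
  induction h with
  | nil h => exact h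
  | cons l g k _ h ih => linarith [(hd l).nonneg g k]

theorem Close.symm {w z : List (Σ l, G l)} {c : ℝ} (h : Close d w z c) : Close d z w c := by
  induction h with
  | nil h => exact .nil h
  | cons l g k _ h ih => exact .cons l k g ih (by rwa [(hd l).symm])

theorem Close.trans {w z t : List (Σ l, G l)} {c c' : ℝ} (h : Close d w z c)
    (h' : Close d z t c') : Close d w t (c + c') := by
  induction h generalizing t c' with
  | nil h => exact h'.mono (by linarith)
  | cons l g k _ h ih =>
    obtain ⟨k', t', b, rfl, h1, h2⟩ := h'.of_cons
    exact .cons l g k' (ih h1) (by linarith [(hd l).triangle g k k'])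

variable {φ : ∀ l, A →* G l}

/-- A perturbation of the shortened word lifts to a perturbation of the original one. -/
theorem Step.lift_close {w w' z' : List (Σ l, G l)} {c : ℝ} (hs : Step φ w w')
    (h : Close d w' z' c) : ∃ z, Close d w z c ∧ wordProd φ z = wordProd φ z' := by
  induction hs generalizing z' c with
  | merge l g h' y =>
    obtain ⟨k, t, b, rfl, h1, h2⟩ := h.of_cons
    refine ⟨⟨l, g⟩ :: ⟨l, g⁻¹ * k⟩ :: t, .cons _ _ _ (.cons _ _ _ h1 le_rfl) ?_,
      by simp [mul_assoc]⟩
    rw [(hd l).self, ← (hd l).mul_left g h']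
    simpa using h2
  | absorbRight m a l k y =>
    obtain ⟨k', t, b, rfl, h1, h2⟩ := h.of_cons
    refine ⟨⟨m, φ m a⟩ :: ⟨l, (φ l a)⁻¹ * k'⟩ :: t, .cons _ _ _ (.cons _ _ _ h1 le_rfl) ?_,
      by simp [PushoutI.of_apply_eq_base, mul_assoc]⟩
    rw [(hd m).self, ← (hd l).mul_left (φ l a) k]
    simpa using h2
  | absorbLeft l k m a y =>
    obtain ⟨k', t, b, rfl, h1, h2⟩ := h.of_cons
    refine ⟨⟨l, k' * (φ l a)⁻¹⟩ :: ⟨m, φ m a⟩ :: t, .cons _ _ _ (.cons _ _ _ h1 le_rfl) ?_,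
      by simp [PushoutI.of_apply_eq_base, ← mul_assoc]⟩
    rw [(hd m).self, ← (hd l).mul_right (φ l a) k]
    simpa using h2
  | cons p _ ih =>
    obtain ⟨k, t, b, rfl, h1, h2⟩ := Close.of_cons (g := p.2) h
    obtain ⟨z, hz, hz'⟩ := ih h1
    exact ⟨⟨p.1, k⟩ :: z, .cons _ _ _ hz h2, by simp [hz']⟩

end Close

section Main

variable {d : ∀ l, G l → G l → ℝ} (hd : ∀ l, IsTSIMetric (d l)) {φ : ∀ l, A →* G l}
  (hinj : ∀ l, Function.Injective (φ l))
  (hagree : ∀ (l₁ l₂ : Λ) (a a' : A), d l₁ (φ l₁ a) (φ l₁ a') = d l₂ (φ l₂ a) (φ l₂ a'))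

include hd hinj hagree in
/-- If a word spells the identity, its first letter can be deleted at the cost of changing the
other letters by a total of at most the length of that letter. -/
theorem exists_close_of_mul_eq_one {l : Λ} (h : G l) (y : List (Σ l, G l))
    (hy : PushoutI.of (φ := φ) l h * wordProd φ y = 1) :
    ∃ y', Close d y y' (d l h 1) ∧ wordProd φ y' = 1 := by
  induction hn : y.length using Nat.strong_induction_on generalizing y with
  | _ n ih =>
    obtain _ | ⟨⟨m, k⟩, t⟩ := y
    · exact ⟨[], .nil ((hd l).nonneg _ _), rfl⟩
    by_cases hh : h ∈ (φ l).range
    · obtain ⟨a, rfl⟩ := hh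
      refine ⟨⟨m, φ m a * k⟩ :: t, .cons _ _ _ (Close.refl hd t) ?_, ?_⟩
      · have h1 := (hd m).mul_right k 1 (φ m a)
        have h2 := hagree l m a 1
        rw [map_one, map_one] at h2
        rw [one_mul] at h1
        rw [h1, h2, (hd m).symm, add_zero]
      · simpa [PushoutI.of_apply_eq_base, mul_assoc] using hy
    by_cases hlm : l = m
    · subst hlm
      refine ⟨⟨l, h * k⟩ :: t, .cons _ _ _ (Close.refl hd t) ?_, ?_⟩
      · have h1 := (hd l).mul_right k 1 h
        rw [one_mul] at h1
        rw [h1, (hd l).symm, add_zero]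
      · simpa [mul_assoc] using hy
    have key : IsReducedWord φ (⟨m, k⟩ :: t) →
        ∃ y', Close d (⟨m, k⟩ :: t) y' (d l h 1) ∧ wordProd φ y' = 1 := by
      intro hr
      have : IsReducedWord φ (⟨l, h⟩ :: ⟨m, k⟩ :: t) := by
        refine ⟨List.isChain_cons_cons.2 ⟨hlm, hr.1⟩, fun p hp => ?_⟩
        obtain rfl | hp := List.mem_cons.1 hp
        · exact hh
        · exact hr.2 p hp
      have := this.eq_nil hinj (by simpa using hy)
      simp at this
    obtain h0 | ⟨p, hp⟩ | hr | ⟨w', hw'⟩ := exists_step φ (⟨m, k⟩ :: t)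
    · cases h0
    · obtain ⟨-, rfl⟩ := List.cons.inj hp
      refine key ⟨by simp, ?_⟩
      rintro _ hp'
      obtain rfl := List.mem_singleton.1 hp'
      rintro ⟨a, ha⟩
      change φ m a = k at ha
      subst ha
      refine hh ⟨a⁻¹, PushoutI.of_injective hinj l ?_⟩
      rw [eq_comm]
      simpa [PushoutI.of_apply_eq_base, mul_eq_one_iff_eq_inv] using hy
    · exact key hr
    · rw [hw'.wordProd_eq] at hy
      obtain ⟨z', hz', h1⟩ := ih _ (by have := hw'.length_eq; omega) w' hy rfl
      obtain ⟨z, hz, h2⟩ := hw'.lift_close hd hz'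
      exact ⟨z, hz, h2.trans h1⟩

include hd in
theorem nearTrivial_self {w : List (Σ l, G l)} (h : wordProd φ w = 1) : NearTrivial φ d w 0 :=
  ⟨w, Close.refl hd w, h⟩

include hd in
theorem Step.nearTrivial {w w' : List (Σ l, G l)} {c : ℝ} (hs : Step φ w w')
    (h : NearTrivial φ d w' c) : NearTrivial φ d w c := by
  obtain ⟨z', hz', h1⟩ := h
  obtain ⟨z, hz, h2⟩ := hs.lift_close hd hz'
  exact ⟨z, hz, h2.trans h1⟩

include hd hinj hagree in
theorem NearTrivial.remove_one {x y : List (Σ l, G l)} {l : Λ} {c : ℝ}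
    (h : NearTrivial φ d (x ++ ⟨l, 1⟩ :: y) c) : NearTrivial φ d (x ++ y) c := by
  obtain ⟨z, hz, hz1⟩ := h
  obtain ⟨x', _, b, b', rfl, hx, hy, hb⟩ := hz.of_append
  obtain ⟨k, y', b'', rfl, hy, hb'⟩ := hy.of_cons
  have h1 : PushoutI.of (φ := φ) l k * wordProd φ (y' ++ x') = 1 := by
    rw [wordProd_append, wordProd_cons] at hz1
    rw [wordProd_append, ← mul_assoc]
    exact mul_eq_one_symm hz1
  obtain ⟨t, ht, ht1⟩ := exists_close_of_mul_eq_one hd hinj hagree k _ h1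
  obtain ⟨y'', x'', e, e', rfl, hy', hx', he⟩ := ht.of_append
  refine ⟨x'' ++ y'', ((hx.trans hd hx').append (hy.trans hd hy')).mono ?_, ?_⟩
  · rw [(hd l).symm] at hb'
    linarith
  · rw [wordProd_append] at ht1 ⊢
    exact mul_eq_one_symm ht1

include hd in
theorem NearTrivial.merge {x y : List (Σ l, G l)} {l : Λ} {g h : G l} {c : ℝ}
    (H : NearTrivial φ d (x ++ ⟨l, g⟩ :: ⟨l, h⟩ :: y) c) :
    NearTrivial φ d (x ++ ⟨l, g * h⟩ :: y) c := by
  obtain ⟨z, hz, hz1⟩ := H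
  obtain ⟨x', _, b, b', rfl, hx, hy, hb⟩ := hz.of_append
  obtain ⟨k, _, b'', rfl, hy, hb'⟩ := hy.of_cons
  obtain ⟨k', y', e, rfl, hy, he⟩ := hy.of_cons
  refine ⟨x' ++ ⟨l, k * k'⟩ :: y', (hx.append (.cons _ _ _ hy le_rfl)).mono ?_, ?_⟩
  · have h1 := (hd l).triangle (g * h) (g * k') (k * k')
    rw [(hd l).mul_left, (hd l).mul_right] at h1
    linarith
  · simpa [mul_assoc] using hz1

include hd hinj hagree in
theorem NearTrivial.swap {x y : List (Σ l, G l)} {l : Λ} (m : Λ) {a : A} {c : ℝ}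
    (h : NearTrivial φ d (x ++ ⟨l, φ l a⟩ :: y) c) :
    NearTrivial φ d (x ++ ⟨m, φ m a⟩ :: y) c := by
  obtain ⟨z, hz, hz1⟩ := h
  obtain ⟨x', _, b, b', rfl, hx, hy, hb⟩ := hz.of_append
  obtain ⟨k, y', b'', rfl, hy, hb'⟩ := hy.of_cons
  have h1 : NearTrivial φ d ((x ++ [⟨m, φ m a⟩]) ++ ⟨l, 1⟩ :: y) c := by
    refine ⟨(x' ++ [⟨m, φ m a⟩]) ++ ⟨l, (φ l a)⁻¹ * k⟩ :: y',
      ((hx.append (Close.refl hd _)).append (.cons _ _ _ hy le_rfl)).mono ?_, ?_⟩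
    · have h2 := (hd l).mul_left (φ l a) 1 ((φ l a)⁻¹ * k)
      rw [mul_one, mul_inv_cancel_left] at h2
      linarith
    · simpa [PushoutI.of_apply_eq_base, mul_assoc] using hz1
  simpa using h1.remove_one hd hinj hagree

include hd hinj hagree in
theorem NearTrivial.step {x w w' : List (Σ l, G l)} {c : ℝ} (hs : Step φ w w')
    (h : NearTrivial φ d (x ++ w) c) : NearTrivial φ d (x ++ w') c := by
  induction hs generalizing x with
  | merge l g g' y => exact h.merge hd
  | absorbRight m a l k y => exact (h.swap hd hinj hagree l).merge hd
  | absorbLeft l k m a y =>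
    refine NearTrivial.merge hd ?_
    rw [List.append_cons] at h ⊢
    exact h.swap hd hinj hagree l
  | cons p _ ih =>
    rw [List.append_cons] at h ⊢
    exact ih h

include hd hinj hagree in
theorem NearTrivial.of_append {x v : List (Σ l, G l)} {c : ℝ}
    (h : NearTrivial φ d (x ++ v) c) (hv : wordProd φ v = 1) : NearTrivial φ d x c := by
  induction hn : v.length using Nat.strong_induction_on generalizing v with
  | _ n ih =>
    obtain rfl | ⟨⟨l, g⟩, rfl⟩ | hr | ⟨v', hv'⟩ := exists_step φ v
    · simpa using h
    · have hg : g = 1 := PushoutI.of_injective hinj l (by simpa using hv)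
      subst hg
      simpa using h.remove_one hd hinj hagree
    · obtain rfl := hr.eq_nil hinj hv
      simpa using h
    · exact ih _ (by have := hv'.length_eq; omega) (h.step hd hinj hagree hv')
        (hv'.wordProd_eq ▸ hv) rfl

include hd hinj hagree in
/-- Being within `c` of a word spelling the identity depends only on the group element spelled. -/
theorem NearTrivial.congr {v w : List (Σ l, G l)} {c : ℝ} (h : NearTrivial φ d w c)
    (hvw : wordProd φ v = wordProd φ w) : NearTrivial φ d v c := by
  obtain ⟨z, hz, hz1⟩ := h
  refine NearTrivial.of_append hd hinj hagree (v := wordInv w ++ w) ?_ (by simp)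
  refine ⟨v ++ (wordInv w ++ z), ?_, by simp [hz1, hvw]⟩
  simpa using (Close.refl hd v).append ((Close.refl hd (wordInv w)).append hz)

theorem exists_pos_le_of_reduced (hclosed : ∀ l, IsDClosed (d l) (Set.range (φ l)))
    (w : List (Σ l, G l)) (hw : ∀ p ∈ w, p.2 ∉ (φ p.1).range) :
    ∃ ε : ℝ, 0 < ε ∧ ∀ p ∈ w, ∀ a : A, ε ≤ d p.1 p.2 (φ p.1 a) := by
  induction w with
  | nil => exact ⟨1, one_pos, by simp⟩
  | cons p w ih =>
    obtain ⟨ε, hε, h⟩ := ih fun q hq => hw q (List.mem_cons_of_mem _ hq)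
    have hp : ∃ ε : ℝ, 0 < ε ∧ ∀ a : A, ε ≤ d p.1 p.2 (φ p.1 a) := by
      by_contra! hcon
      refine hw p List.mem_cons_self (hclosed p.1 p.2 fun ε hε => ?_)
      obtain ⟨a, ha⟩ := hcon ε hε
      exact ⟨_, ⟨a, rfl⟩, ha⟩
    obtain ⟨ε', hε', h'⟩ := hp
    refine ⟨min ε ε', lt_min hε hε', fun q hq a => ?_⟩
    obtain rfl | hq := List.mem_cons.1 hq
    · exact (min_le_right _ _).trans (h' a)
    · exact (min_le_left _ _).trans (h q hq a)

include hd in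
theorem Close.le_of_mem_range {w z : List (Σ l, G l)} {c ε : ℝ} (h : Close d w z c)
    (hε : ∀ p ∈ w, ∀ a : A, ε ≤ d p.1 p.2 (φ p.1 a)) (hz : ∃ p ∈ z, p.2 ∈ (φ p.1).range) :
    ε ≤ c := by
  induction h with
  | nil => simp at hz
  | cons l g k h hc ih =>
    obtain ⟨p, hp, hp'⟩ := hz
    obtain rfl | hp := List.mem_cons.1 hp
    · obtain ⟨a, ha⟩ := hp'
      change φ l a = k at ha
      subst ha
      linarith [hε _ List.mem_cons_self a, h.nonneg hd]
    · linarith [ih (fun q hq => hε q (List.mem_cons_of_mem _ hq)) ⟨p, hp, hp'⟩,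
        (hd l).nonneg g k]

include hinj in
theorem NearTrivial.le_of_singleton {l : Λ} {g : G l} {c : ℝ}
    (h : NearTrivial φ d [⟨l, g⟩] c) : d l g 1 ≤ c := by
  obtain ⟨z, hz, hz1⟩ := h
  obtain ⟨k, _, b, rfl, h1, h2⟩ := hz.of_cons
  cases h1 with
  | nil hb =>
    have hk : k = 1 := PushoutI.of_injective hinj l (by simpa using hz1)
    subst hk
    linarith

include hd hinj hagree in
theorem exists_pos_le_of_wordProd_ne_one (hclosed : ∀ l, IsDClosed (d l) (Set.range (φ l)))
    (w : List (Σ l, G l)) (hw : wordProd φ w ≠ 1) :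
    ∃ ε : ℝ, 0 < ε ∧ ∀ c, NearTrivial φ d w c → ε ≤ c := by
  induction hn : w.length using Nat.strong_induction_on generalizing w with
  | _ n ih =>
    obtain rfl | ⟨⟨l, g⟩, rfl⟩ | hr | ⟨w', hw'⟩ := exists_step φ w
    · exact absurd rfl hw
    · refine ⟨d l g 1, ((hd l).nonneg _ _).lt_of_ne' fun h0 => hw ?_,
        fun c hc => hc.le_of_singleton hinj⟩
      simp [((hd l).1 _ _).1 h0]
    · obtain ⟨ε, hε, h⟩ := exists_pos_le_of_reduced hclosed w hr.2
      refine ⟨ε, hε, fun c ⟨z, hz, hz1⟩ => hz.le_of_mem_range hd h ?_⟩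
      by_contra! hcon
      have hzr : IsReducedWord φ z := ⟨hz.isChain_iff.1 hr.1, hcon⟩
      obtain rfl := hzr.eq_nil hinj hz1
      cases hz
      exact hw rfl
    · obtain ⟨ε, hε, h⟩ := ih _ (by have := hw'.length_eq; omega) w' (hw'.wordProd_eq ▸ hw) rfl
      exact ⟨ε, hε, fun c hc => h c (NearTrivial.step hd hinj hagree (x := []) hw' hc)⟩

include hinj in
theorem exists_of_mul_of_eq_one {l m : Λ} (hlm : l ≠ m) {g : G l} {h : G m}
    (H : PushoutI.of (φ := φ) l g * PushoutI.of (φ := φ) m h = 1) :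
    ∃ a : A, g = (φ l a)⁻¹ ∧ h = φ m a := by
  have hmem : PushoutI.of (φ := φ) m h ∈ (PushoutI.base φ).range := by
    rw [← PushoutI.inf_of_range_eq_base_range hinj hlm]
    exact ⟨⟨g⁻¹, by rw [map_inv, inv_eq_of_mul_eq_one_right H]⟩, ⟨h, rfl⟩⟩
  obtain ⟨a, ha⟩ := hmem
  refine ⟨a, PushoutI.of_injective hinj l ?_, PushoutI.of_injective hinj m ?_⟩
  · rw [map_inv, PushoutI.of_apply_eq_base, ha]
    exact eq_inv_of_mul_eq_one_left H
  · rw [PushoutI.of_apply_eq_base, ha]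

/-- The upper bounds for the Graev norm of `x` that are witnessed by words. -/
def normBounds (φ : ∀ l, A →* G l) (d : ∀ l, G l → G l → ℝ) (x : PushoutI φ) : Set ℝ :=
  {c | ∃ w, wordProd φ w = x ∧ NearTrivial φ d w c}

/-- The Graev norm on the amalgamated product. -/
noncomputable def norm (φ : ∀ l, A →* G l) (d : ∀ l, G l → G l → ℝ) (x : PushoutI φ) : ℝ :=
  sInf (normBounds φ d x)

theorem exists_close_one (z : List (Σ l, G l)) (d : ∀ l, G l → G l → ℝ) :
    ∃ (t : List (Σ l, G l)) (c : ℝ), Close d z t c ∧ wordProd φ t = 1 := by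
  induction z with
  | nil => exact ⟨[], 0, .nil le_rfl, rfl⟩
  | cons p z ih =>
    obtain ⟨t, c, h, ht⟩ := ih
    exact ⟨⟨p.1, 1⟩ :: t, _, .cons _ _ _ h le_rfl, by simp [ht]⟩

theorem normBounds_nonempty [Nonempty Λ] (x : PushoutI φ) : (normBounds φ d x).Nonempty := by
  obtain ⟨w, rfl⟩ := exists_wordProd_eq φ x
  obtain ⟨t, c, h, ht⟩ := exists_close_one (φ := φ) w d
  exact ⟨c, w, rfl, t, h, ht⟩

include hd in
theorem nonneg_of_mem_normBounds {x : PushoutI φ} {c : ℝ} (h : c ∈ normBounds φ d x) : 0 ≤ c := by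
  obtain ⟨w, -, z, hz, -⟩ := h
  exact hz.nonneg hd

include hd in
theorem norm_le {x : PushoutI φ} {c : ℝ} (h : c ∈ normBounds φ d x) : norm φ d x ≤ c :=
  csInf_le ⟨0, fun _ h => nonneg_of_mem_normBounds hd h⟩ h

theorem le_norm [Nonempty Λ] {x : PushoutI φ} {b : ℝ} (h : ∀ c ∈ normBounds φ d x, b ≤ c) :
    b ≤ norm φ d x :=
  le_csInf (normBounds_nonempty x) h

include hd in
theorem norm_one [Nonempty Λ] : norm φ d 1 = 0 :=
  le_antisymm (norm_le hd ⟨[], rfl, nearTrivial_self hd rfl⟩)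
    (le_norm fun _ h => nonneg_of_mem_normBounds hd h)

include hd hinj hagree in
theorem eq_one_of_norm_eq_zero [Nonempty Λ] (hclosed : ∀ l, IsDClosed (d l) (Set.range (φ l)))
    {x : PushoutI φ} (hx : norm φ d x = 0) : x = 1 := by
  by_contra hne
  obtain ⟨w, rfl⟩ := exists_wordProd_eq φ x
  obtain ⟨ε, hε, h⟩ := exists_pos_le_of_wordProd_ne_one hd hinj hagree hclosed w hne
  have : ε ≤ norm φ d (wordProd φ w) :=
    le_norm fun c ⟨v, hv, hc⟩ => h c (hc.congr hd hinj hagree hv.symm)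
  linarith

include hd in
theorem norm_inv_le [Nonempty Λ] (x : PushoutI φ) : norm φ d x⁻¹ ≤ norm φ d x := by
  refine le_norm fun c ⟨w, hw, z, hz, hz1⟩ => norm_le hd ?_
  refine ⟨z ++ wordInv w, by simp [hz1, hw], w ++ wordInv w, ?_, by simp⟩
  simpa using (hz.symm hd).append (Close.refl hd (wordInv w))

include hd in
theorem norm_inv [Nonempty Λ] (x : PushoutI φ) : norm φ d x⁻¹ = norm φ d x :=
  le_antisymm (norm_inv_le hd x) (by simpa using norm_inv_le hd x⁻¹)

include hd in
theorem norm_mul_le [Nonempty Λ] (x y : PushoutI φ) :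
    norm φ d (x * y) ≤ norm φ d x + norm φ d y := by
  rw [← sub_le_iff_le_add]
  refine le_norm fun b ⟨v, hv, z, hz, hz1⟩ => ?_
  rw [sub_le_comm]
  refine le_norm fun c ⟨w, hw, t, ht, ht1⟩ => ?_
  rw [sub_le_iff_le_add']
  exact norm_le hd ⟨v ++ w, by simp [hv, hw], z ++ t, hz.append ht, by simp [hz1, ht1]⟩

include hd in
theorem norm_conj_le [Nonempty Λ] (g x : PushoutI φ) :
    norm φ d (g * x * g⁻¹) ≤ norm φ d x := by
  obtain ⟨u, rfl⟩ := exists_wordProd_eq φ g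
  refine le_norm fun c ⟨w, hw, z, hz, hz1⟩ => norm_le hd ?_
  refine ⟨u ++ w ++ wordInv u, by simp [hw, mul_assoc], u ++ z ++ wordInv u, ?_, by simp [hz1]⟩
  simpa using ((Close.refl hd u).append hz).append (Close.refl hd (wordInv u))

include hd in
theorem norm_conj [Nonempty Λ] (g x : PushoutI φ) : norm φ d (g * x * g⁻¹) = norm φ d x := by
  refine le_antisymm (norm_conj_le hd g x) ?_
  simpa [mul_assoc] using norm_conj_le hd g⁻¹ (g * x * g⁻¹)

include hd hinj hagree in
theorem norm_of [Nonempty Λ] (l : Λ) (g : G l) :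
    norm φ d (PushoutI.of (φ := φ) l g) = d l g 1 := by
  refine le_antisymm (norm_le hd ⟨[⟨l, g⟩], by simp, [⟨l, 1⟩], ?_, by simp⟩) ?_
  · exact .cons _ _ _ (.nil le_rfl) (by simp)
  · refine le_norm fun c ⟨w, hw, hc⟩ => NearTrivial.le_of_singleton hinj (φ := φ) ?_
    exact hc.congr hd hinj hagree (by simp [hw])

include hd hinj hagree in
theorem isTSIMetric_norm [Nonempty Λ] (hclosed : ∀ l, IsDClosed (d l) (Set.range (φ l))) :
    IsTSIMetric fun x y : PushoutI φ => norm φ d (x⁻¹ * y) := by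
  refine ⟨fun x y => ⟨fun h => ?_, ?_⟩, fun x y => ?_, fun x y z => ?_, fun g x y => ?_,
    fun g x y => ?_⟩
  · exact inv_mul_eq_one.1 (eq_one_of_norm_eq_zero hd hinj hagree hclosed h)
  · rintro rfl
    simpa using norm_one hd
  · simpa using norm_inv hd (y⁻¹ * x)
  · simpa [mul_assoc] using norm_mul_le hd (x⁻¹ * y) (y⁻¹ * z)
  · simp [mul_assoc]
  · simpa [mul_assoc] using norm_conj hd g⁻¹ (x⁻¹ * y)

include hd hinj hagree in
theorem extendsAmalgamMetric_norm [Nonempty Λ] :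
    ExtendsAmalgamMetric φ d fun x y : PushoutI φ => norm φ d (x⁻¹ * y) := by
  refine ⟨fun l g h => ?_, fun l m hlm g h => le_antisymm ?_ ?_⟩
  · simp only [← map_inv, ← map_mul]
    rw [norm_of hd hinj hagree, ← (hd l).mul_left g, (hd l).symm]
    simp
  · refine le_ciInf fun a => norm_le hd ?_
    refine ⟨[⟨l, g⁻¹⟩, ⟨m, h⟩], by simp, [⟨l, (φ l a)⁻¹⟩, ⟨m, φ m a⟩], ?_, ?_⟩
    · refine .cons _ _ _ (.cons _ _ _ (.nil le_rfl) le_rfl) ?_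
      rw [(hd l).inv_inv, (hd m).symm h, add_zero]
    · simp [PushoutI.of_apply_eq_base]
  · refine le_norm fun c ⟨w, hw, hc⟩ => ?_
    have hc : NearTrivial φ d [⟨l, g⁻¹⟩, ⟨m, h⟩] c := hc.congr hd hinj hagree (by simp [hw])
    obtain ⟨z, hz, hz1⟩ := hc
    obtain ⟨k, _, b, rfl, hz, h1⟩ := hz.of_cons
    obtain ⟨k', _, b', rfl, hz, h2⟩ := hz.of_cons
    cases hz with
    | nil hb =>
      obtain ⟨a, rfl, rfl⟩ := exists_of_mul_of_eq_one hinj hlm (by simpa using hz1)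
      rw [(hd l).inv_inv] at h1
      rw [(hd m).symm] at h2
      refine (ciInf_le ⟨0, ?_⟩ a).trans (by linarith)
      rintro _ ⟨a, rfl⟩
      exact add_nonneg ((hd l).nonneg _ _) ((hd m).nonneg _ _)

theorem Close.dist_wordProd_le {δ : PushoutI φ → PushoutI φ → ℝ} (hδ : IsTSIMetric δ)
    (hext : ExtendsAmalgamMetric φ d δ) {w z : List (Σ l, G l)} {c : ℝ} (h : Close d w z c) :
    δ (wordProd φ w) (wordProd φ z) ≤ c := by
  induction h with
  | nil h => rwa [hδ.self]
  | @cons l g k w z _ _ _ hc ih =>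
    have h1 := hδ.triangle (wordProd φ (⟨l, g⟩ :: w)) (PushoutI.of l k * wordProd φ w)
      (wordProd φ (⟨l, k⟩ :: z))
    rw [wordProd_cons, wordProd_cons, hδ.mul_left, hδ.mul_right, hext.1] at h1
    rw [wordProd_cons, wordProd_cons]
    linarith

end Main

end GraevMetric

/-- There exists a two-sided invariant metric on the amalgamated free product extending the
amalgam metric which is maximal among all such metrics. -/
theorem graev_metric_maximal {Λ : Type*} [Nonempty Λ] {G : Λ → Type*} [∀ l, Group (G l)]
    (d : ∀ l, G l → G l → ℝ) (hd : ∀ l, IsTSIMetric (d l))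
    {A : Type*} [Group A] (φ : ∀ l, A →* G l)
    (hinj : ∀ l, Function.Injective (φ l))
    (hclosed : ∀ l, IsDClosed (d l) (Set.range (φ l)))
    (hagree : ∀ (l₁ l₂ : Λ) (a a' : A), d l₁ (φ l₁ a) (φ l₁ a') = d l₂ (φ l₂ a) (φ l₂ a')) :
    ∃ dbar : Monoid.PushoutI φ → Monoid.PushoutI φ → ℝ,
      IsTSIMetric dbar ∧ ExtendsAmalgamMetric φ d dbar ∧
      ∀ δ : Monoid.PushoutI φ → Monoid.PushoutI φ → ℝ,
        IsTSIMetric δ → ExtendsAmalgamMetric φ d δ →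
        ∀ x y : Monoid.PushoutI φ, δ x y ≤ dbar x y := by
  refine ⟨fun x y => GraevMetric.norm φ d (x⁻¹ * y),
    GraevMetric.isTSIMetric_norm hd hinj hagree hclosed,
    GraevMetric.extendsAmalgamMetric_norm hd hinj hagree, fun δ hδ hext x y => ?_⟩
  refine GraevMetric.le_norm fun c ⟨w, hw, z, hz, hz1⟩ => ?_
  have h := hz.dist_wordProd_le hδ hext
  rwa [hw, hz1, ← hδ.mul_left x, mul_inv_cancel_left, mul_one, hδ.symm] at h
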